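/- arXiv:1208.4765 — 3 statements merged into one kernel-verified Lean document; each statement's English description precedes it below -/
import Mathlib

section
/- Let f : ℝ^d → ℝ^d be twice continuously differentiable with f, Df and D²f bounded on ℝ^d, let ξ ∈ ℝ^d satisfy f(ξ) = 0, and fix h > 0. Then there exists C > 0 such that for all y ∈ ℝ^d, ‖(ϑ₁(h·Df(y)) − ϑ₁(h·Df(ξ)))(f(y))‖ ≤ C·‖y − ξ‖². -/
noncomputable section

variable {d : ℕ}

/-- `ϑ₁(X) := ∑_{k=0}^∞ X^k/(k+1)!` (and more generally `ϑ_j`) for a bounded linear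
operator `X` on `ℝ^d`. -/
def vartheta (j : ℕ) (X : EuclideanSpace ℝ (Fin d) →L[ℝ] EuclideanSpace ℝ (Fin d)) :
    EuclideanSpace ℝ (Fin d) →L[ℝ] EuclideanSpace ℝ (Fin d) :=
  ∑' k : ℕ, (((k + j).factorial : ℝ))⁻¹ • X ^ k

/-- `‖X ^ k‖ ≤ ‖X‖ ^ k` also on the trivial space, where `‖1‖ = 0`. -/
theorem opNorm_pow_le {E : Type*} [NormedAddCommGroup E] [NormedSpace ℝ E]
    (X : E →L[ℝ] E) (k : ℕ) : ‖X ^ k‖ ≤ ‖X‖ ^ k := by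
  cases k with
  | zero => simpa using! ContinuousLinearMap.norm_id_le (𝕜 := ℝ) (E := E)
  | succ k => exact norm_pow_le' X k.succ_pos

/-- Powers are Lipschitz on bounded subsets of `E →L[ℝ] E`. -/
theorem norm_pow_sub_pow_le {E : Type*} [NormedAddCommGroup E] [NormedSpace ℝ E]
    {X Y : E →L[ℝ] E} {M : ℝ} (hM : 1 ≤ M) (hX : ‖X‖ ≤ M) (hY : ‖Y‖ ≤ M) (k : ℕ) :
    ‖X ^ k - Y ^ k‖ ≤ k * M ^ k * ‖X - Y‖ := by
  induction k with
  | zero => simp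
  | succ k ih =>
    have hpow : ‖X ^ k‖ ≤ M ^ k := (opNorm_pow_le X k).trans (by gcongr)
    calc ‖X ^ (k + 1) - Y ^ (k + 1)‖ = ‖X ^ k * (X - Y) + (X ^ k - Y ^ k) * Y‖ := by
          congr 1; noncomm_ring
      _ ≤ ‖X ^ k‖ * ‖X - Y‖ + ‖X ^ k - Y ^ k‖ * ‖Y‖ :=
          (norm_add_le _ _).trans (add_le_add (norm_mul_le _ _) (norm_mul_le _ _))
      _ ≤ M ^ k * ‖X - Y‖ + k * M ^ k * ‖X - Y‖ * M := by gcongr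
      _ ≤ M ^ (k + 1) * ‖X - Y‖ + k * M ^ k * ‖X - Y‖ * M := by
          gcongr
          exact k.le_succ
      _ = (k + 1 : ℕ) * M ^ (k + 1) * ‖X - Y‖ := by push_cast; ring

theorem summable_vartheta (j : ℕ)
    (X : EuclideanSpace ℝ (Fin d) →L[ℝ] EuclideanSpace ℝ (Fin d)) :
    Summable fun k : ℕ ↦ (((k + j).factorial : ℝ))⁻¹ • X ^ k := by
  refine .of_norm_bounded (Real.summable_pow_div_factorial ‖X‖) fun k ↦ ?_
  rw [norm_smul, norm_inv, Real.norm_natCast, div_eq_inv_mul]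
  gcongr
  · exact k.le_add_right j
  · exact opNorm_pow_le X k

/-- `ϑ_j` is Lipschitz on bounded sets. -/
theorem norm_vartheta_sub_le (j : ℕ)
    {X Y : EuclideanSpace ℝ (Fin d) →L[ℝ] EuclideanSpace ℝ (Fin d)} {M : ℝ}
    (hM : 1 ≤ M) (hX : ‖X‖ ≤ M) (hY : ‖Y‖ ≤ M) :
    ‖vartheta j X - vartheta j Y‖ ≤ Real.exp (2 * M) * ‖X - Y‖ := by
  rw [vartheta, vartheta, ← (summable_vartheta j X).tsum_sub (summable_vartheta j Y)]
  have hexp : HasSum (fun k : ℕ ↦ (2 * M) ^ k / k.factorial) (Real.exp (2 * M)) := by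
    rw [Real.exp_eq_exp_ℝ]
    exact NormedSpace.expSeries_div_hasSum_exp (2 * M)
  refine tsum_of_norm_bounded (hexp.mul_right _) fun k ↦ ?_
  have hsub := smul_sub ((k + j).factorial : ℝ)⁻¹ (X ^ k) (Y ^ k)
  rw [← hsub, norm_smul, norm_inv, Real.norm_natCast, div_eq_inv_mul, mul_assoc]
  gcongr
  · exact k.le_add_right j
  · refine (norm_pow_sub_pow_le hM hX hY k).trans ?_
    rw [mul_pow]
    gcongr
    exact_mod_cast k.lt_two_pow_self.le

/-- If `f`, `Df`, `D²f` are bounded, `f(ξ) = 0` and `h > 0`, then there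
is `C > 0` with `‖(ϑ₁(h·Df(y)) − ϑ₁(h·Df(ξ)))(f(y))‖ ≤ C·‖y − ξ‖²` for all `y`. -/
theorem vartheta_one_difference_estimate (d : ℕ)
    (f : EuclideanSpace ℝ (Fin d) → EuclideanSpace ℝ (Fin d)) (hf : ContDiff ℝ 2 f)
    (hbd : ∀ i ≤ 2, ∃ B : ℝ, ∀ x, ‖iteratedFDeriv ℝ i f x‖ ≤ B)
    (ξ : EuclideanSpace ℝ (Fin d)) (hξ : f ξ = 0) (h : ℝ) (hh : 0 < h) :
    ∃ C > 0, ∀ y : EuclideanSpace ℝ (Fin d),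
      ‖(vartheta 1 (h • fderiv ℝ f y) - vartheta 1 (h • fderiv ℝ f ξ)) (f y)‖
        ≤ C * ‖y - ξ‖ ^ 2 := by
  obtain ⟨B₁, hB₁⟩ := hbd 1 (by norm_num)
  obtain ⟨B₂, hB₂⟩ := hbd 2 le_rfl
  simp only [norm_iteratedFDeriv_one] at hB₁
  have hD (x) : ‖fderiv ℝ (fderiv ℝ f) x‖ ≤ B₂ := by
    rw [← norm_iteratedFDeriv_one, norm_iteratedFDeriv_fderiv]
    exact hB₂ x
  have hB₁0 : 0 ≤ B₁ := (norm_nonneg _).trans (hB₁ ξ)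
  have hB₂0 : 0 ≤ B₂ := (norm_nonneg _).trans (hB₂ ξ)
  have hf' : Differentiable ℝ (fderiv ℝ f) :=
    (hf.fderiv_right (m := 1) (by norm_num)).differentiable (by norm_num)
  have hlip (y) : ‖f y‖ ≤ B₁ * ‖y - ξ‖ := by
    simpa [hξ] using convex_univ.norm_image_sub_le_of_norm_fderiv_le
      (fun x _ ↦ hf.differentiable (by norm_num) x) (fun x _ ↦ hB₁ x)
      (Set.mem_univ ξ) (Set.mem_univ y)
  have hlip' (y) : ‖fderiv ℝ f y - fderiv ℝ f ξ‖ ≤ B₂ * ‖y - ξ‖ :=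
    convex_univ.norm_image_sub_le_of_norm_fderiv_le
      (fun x _ ↦ hf' x) (fun x _ ↦ hD x) (Set.mem_univ ξ) (Set.mem_univ y)
  have hsmul (y) : ‖h • fderiv ℝ f y‖ ≤ h * B₁ + 1 := by
    rw [norm_smul, Real.norm_of_nonneg hh.le]
    linarith [mul_le_mul_of_nonneg_left (hB₁ y) hh.le]
  refine ⟨Real.exp (2 * (h * B₁ + 1)) * (h * B₂) * B₁ + 1, by positivity, fun y ↦ ?_⟩
  calc ‖(vartheta 1 (h • fderiv ℝ f y) - vartheta 1 (h • fderiv ℝ f ξ)) (f y)‖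
      ≤ ‖vartheta 1 (h • fderiv ℝ f y) - vartheta 1 (h • fderiv ℝ f ξ)‖ * ‖f y‖ :=
        ContinuousLinearMap.le_opNorm _ _
    _ ≤ Real.exp (2 * (h * B₁ + 1)) * ‖h • fderiv ℝ f y - h • fderiv ℝ f ξ‖ * ‖f y‖ := by
        gcongr
        exact norm_vartheta_sub_le 1 (le_add_of_nonneg_left (by positivity)) (hsmul y) (hsmul ξ)
    _ ≤ Real.exp (2 * (h * B₁ + 1)) * (h * (B₂ * ‖y - ξ‖)) * (B₁ * ‖y - ξ‖) := by
        have hsub := smul_sub h (fderiv ℝ f y) (fderiv ℝ f ξ)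
        rw [← hsub, norm_smul, Real.norm_of_nonneg hh.le]
        gcongr
        · exact hlip' y
        · exact hlip y
    _ = Real.exp (2 * (h * B₁ + 1)) * (h * B₂) * B₁ * ‖y - ξ‖ ^ 2 := by ring
    _ ≤ (Real.exp (2 * (h * B₁ + 1)) * (h * B₂) * B₁ + 1) * ‖y - ξ‖ ^ 2 := by
        gcongr
        exact le_add_of_nonneg_right zero_le_one

end
end

section
/- Let f : ℝ^d → ℝ^d be twice continuously differentiable with f, Df and D²f bounded on ℝ^d, let ξ ∈ ℝ^d satisfy f(ξ) = 0, and fix h > 0. Then there exists C > 0 such that for all y ∈ ℝ^d and every stage index i ∈ {1,…,s}, ‖k_i(y,h)‖ ≤ C·‖y − ξ‖². -/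
noncomputable section

variable {d : ℕ}

/-- `Φf(ξ,δ) := ϑ₁(δ·Df(ξ))(f(ξ))`. -/
def Phif (f : EuclideanSpace ℝ (Fin d) → EuclideanSpace ℝ (Fin d))
    (ξ : EuclideanSpace ℝ (Fin d)) (δ : ℝ) : EuclideanSpace ℝ (Fin d) :=
  vartheta 1 (δ • fderiv ℝ f ξ) (f ξ)

/-- `q(ξ; δ, u) := f(ξ + δ·Φf(ξ,δ) + u) − δ·Df(ξ)(Φf(ξ,δ)) − f(ξ)`. -/
def qf (f : EuclideanSpace ℝ (Fin d) → EuclideanSpace ℝ (Fin d))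
    (ξ : EuclideanSpace ℝ (Fin d)) (δ : ℝ) (u : EuclideanSpace ℝ (Fin d)) :
    EuclideanSpace ℝ (Fin d) :=
  f (ξ + δ • Phif f ξ δ + u) - δ • fderiv ℝ f ξ (Phif f ξ δ) - f ξ

/-- The Runge–Kutta stages `k_i(ξ,δ) := q(ξ; c_i·δ, δ·∑_{j<i} a_{ij}·k_j(ξ,δ))`. -/
def kstage (f : EuclideanSpace ℝ (Fin d) → EuclideanSpace ℝ (Fin d))
    (c : ℕ → ℝ) (a : ℕ → ℕ → ℝ) (ξ : EuclideanSpace ℝ (Fin d)) (δ : ℝ) (i : ℕ) :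
    EuclideanSpace ℝ (Fin d) :=
  Nat.strongRecOn i fun i ih =>
    qf f ξ (c i * δ) (δ • ∑ j : Fin i, a i (j : ℕ) • ih (j : ℕ) j.isLt)

/-- The LLRK increment map `φ_γ(ξ,δ) := Φf(ξ,δ) + ∑_{i=1}^s b_i·k_i(ξ,δ)`. -/
def phiGamma (f : EuclideanSpace ℝ (Fin d) → EuclideanSpace ℝ (Fin d))
    (c : ℕ → ℝ) (a : ℕ → ℕ → ℝ) (b : ℕ → ℝ) (s : ℕ)
    (ξ : EuclideanSpace ℝ (Fin d)) (δ : ℝ) : EuclideanSpace ℝ (Fin d) :=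
  Phif f ξ δ + ∑ i ∈ Finset.range s, b i • kstage f c a ξ δ i

variable {f : EuclideanSpace ℝ (Fin d) → EuclideanSpace ℝ (Fin d)}

theorem norm_vartheta_one_le (X : EuclideanSpace ℝ (Fin d) →L[ℝ] EuclideanSpace ℝ (Fin d)) :
    ‖vartheta 1 X‖ ≤ Real.exp ‖X‖ := by
  have hs : HasSum (fun k : ℕ => ‖X‖ ^ k / (k.factorial : ℝ)) (Real.exp ‖X‖) := by
    rw [Real.exp_eq_exp_ℝ]
    exact NormedSpace.expSeries_div_hasSum_exp ‖X‖
  refine tsum_of_norm_bounded hs fun k => ?_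
  have hX : ‖X ^ k‖ ≤ ‖X‖ ^ k := by
    rcases k.eq_zero_or_pos with rfl | hk
    · rw [pow_zero, pow_zero]
      exact ContinuousLinearMap.norm_id_le
    · exact norm_pow_le' X hk
  have hk : (k.factorial : ℝ) ≤ ((k + 1).factorial : ℝ) := by
    exact_mod_cast Nat.factorial_le k.le_succ
  have hk0 : (0 : ℝ) < k.factorial := by exact_mod_cast k.factorial_pos
  rw [norm_smul, norm_inv, Real.norm_natCast, div_eq_inv_mul]
  gcongr

theorem norm_Phif_le {L : ℝ} (hL : ∀ x, ‖fderiv ℝ f x‖ ≤ L)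
    (y : EuclideanSpace ℝ (Fin d)) (δ : ℝ) :
    ‖Phif f y δ‖ ≤ Real.exp (|δ| * L) * ‖f y‖ := by
  refine (ContinuousLinearMap.le_opNorm _ _).trans ?_
  gcongr
  refine (norm_vartheta_one_le _).trans (Real.exp_le_exp.2 ?_)
  rw [norm_smul, Real.norm_eq_abs]
  gcongr
  exact hL y

theorem norm_sub_le_of_norm_fderiv_le (hf : Differentiable ℝ f) {L : ℝ}
    (hL : ∀ x, ‖fderiv ℝ f x‖ ≤ L) (x y : EuclideanSpace ℝ (Fin d)) :
    ‖f y - f x‖ ≤ L * ‖y - x‖ :=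
  convex_univ.norm_image_sub_le_of_norm_fderiv_le (fun z _ => hf z) (fun z _ => hL z)
    (Set.mem_univ x) (Set.mem_univ y)

theorem norm_taylor_one_remainder_le (hf : ContDiff ℝ 2 f) {M : ℝ}
    (hM : ∀ x, ‖fderiv ℝ (fderiv ℝ f) x‖ ≤ M) (x v : EuclideanSpace ℝ (Fin d)) :
    ‖f (x + v) - f x - fderiv ℝ f x v‖ ≤ M * ‖v‖ ^ 2 := by
  have hd : Differentiable ℝ f := hf.differentiable (by norm_num)
  have hd' : Differentiable ℝ (fderiv ℝ f) :=
    (hf.fderiv_right (m := 1) (by norm_num)).differentiable (by norm_num)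
  have hM0 : 0 ≤ M := (norm_nonneg (fderiv ℝ (fderiv ℝ f) x)).trans (hM x)
  have key := (convex_closedBall x ‖v‖).norm_image_sub_le_of_norm_fderiv_le' (𝕜 := ℝ) (f := f)
    (C := M * ‖v‖) (φ := fderiv ℝ f x) (x := x) (y := x + v) (fun z _ => hd z)
    (fun z hz => (convex_univ.norm_image_sub_le_of_norm_fderiv_le (fun w _ => hd' w)
      (fun w _ => hM w) (Set.mem_univ x) (Set.mem_univ z)).trans
        (mul_le_mul_of_nonneg_left (mem_closedBall_iff_norm.1 hz) hM0))
    (by simp) (by simp)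
  simpa [sq, mul_assoc] using key

theorem norm_qf_le (hf : ContDiff ℝ 2 f) {L M : ℝ} (hL : ∀ x, ‖fderiv ℝ f x‖ ≤ L)
    (hM : ∀ x, ‖fderiv ℝ (fderiv ℝ f) x‖ ≤ M) {ξ : EuclideanSpace ℝ (Fin d)} (hξ : f ξ = 0)
    (y : EuclideanSpace ℝ (Fin d)) (δ : ℝ) (u : EuclideanSpace ℝ (Fin d)) :
    ‖qf f y δ u‖ ≤
      M * (|δ| * (Real.exp (|δ| * L) * L)) ^ 2 * ‖y - ξ‖ ^ 2 + L * ‖u‖ := by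
  have hd : Differentiable ℝ f := hf.differentiable (by norm_num)
  have hM0 : 0 ≤ M := (norm_nonneg (fderiv ℝ (fderiv ℝ f) y)).trans (hM y)
  set v := δ • Phif f y δ with hv
  have hfy : ‖f y‖ ≤ L * ‖y - ξ‖ := by
    simpa [hξ] using norm_sub_le_of_norm_fderiv_le hd hL ξ y
  have hv_le : ‖v‖ ≤ |δ| * (Real.exp (|δ| * L) * L) * ‖y - ξ‖ := by
    rw [hv, norm_smul, Real.norm_eq_abs, mul_assoc, mul_assoc]
    gcongr
    exact (norm_Phif_le hL y δ).trans (by gcongr)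
  have hsplit : qf f y δ u =
      (f (y + v) - f y - fderiv ℝ f y v) + (f (y + v + u) - f (y + v)) := by
    rw [qf, ← hv, ← map_smul, ← hv]
    abel
  have hu : ‖f (y + v + u) - f (y + v)‖ ≤ L * ‖u‖ := by
    simpa using norm_sub_le_of_norm_fderiv_le hd hL (y + v) (y + v + u)
  rw [hsplit]
  refine (norm_add_le _ _).trans (add_le_add ?_ hu)
  refine (norm_taylor_one_remainder_le hf hM y v).trans ?_
  rw [mul_assoc, ← mul_pow]
  gcongr

theorem kstage_eq (f : EuclideanSpace ℝ (Fin d) → EuclideanSpace ℝ (Fin d))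
    (c : ℕ → ℝ) (a : ℕ → ℕ → ℝ) (y : EuclideanSpace ℝ (Fin d)) (δ : ℝ) (i : ℕ) :
    kstage f c a y δ i =
      qf f y (c i * δ) (δ • ∑ j : Fin i, a i (j : ℕ) • kstage f c a y δ j) := by
  unfold kstage
  rw [Nat.strongRecOn_eq]

theorem exists_norm_kstage_le (hf : ContDiff ℝ 2 f) {L M : ℝ} (hL : ∀ x, ‖fderiv ℝ f x‖ ≤ L)
    (hM : ∀ x, ‖fderiv ℝ (fderiv ℝ f) x‖ ≤ M) {ξ : EuclideanSpace ℝ (Fin d)} (hξ : f ξ = 0)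
    (c : ℕ → ℝ) (a : ℕ → ℕ → ℝ) (δ : ℝ) (i : ℕ) :
    ∃ C, 0 ≤ C ∧ ∀ y, ‖kstage f c a y δ i‖ ≤ C * ‖y - ξ‖ ^ 2 := by
  have hL0 : 0 ≤ L := (norm_nonneg _).trans (hL ξ)
  have hM0 : 0 ≤ M := (norm_nonneg (fderiv ℝ (fderiv ℝ f) ξ)).trans (hM ξ)
  induction i using Nat.strong_induction_on with
  | _ i ih =>
    choose C hC0 hC using fun j : Fin i => ih j j.isLt
    refine ⟨M * (|c i * δ| * (Real.exp (|c i * δ| * L) * L)) ^ 2 +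
      L * (|δ| * ∑ j : Fin i, |a i j| * C j), ?_, fun y => ?_⟩
    · have : 0 ≤ ∑ j : Fin i, |a i j| * C j :=
        Finset.sum_nonneg fun j _ => mul_nonneg (abs_nonneg _) (hC0 j)
      positivity
    · rw [kstage_eq, add_mul]
      refine (norm_qf_le hf hL hM hξ y _ _).trans ?_
      rw [mul_assoc L, mul_assoc |δ|, norm_smul, Real.norm_eq_abs δ, Finset.sum_mul]
      gcongr
      refine norm_sum_le_of_le _ fun j _ => ?_
      rw [norm_smul, Real.norm_eq_abs, mul_assoc]
      gcongr
      exact hC j y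

/-- If `f`, `Df`, `D²f` are bounded, `f(ξ) = 0` and `h > 0`, then there
is `C > 0` such that every Runge–Kutta stage satisfies `‖k_i(y,h)‖ ≤ C·‖y − ξ‖²`
for all `y` and all stage indices `i` (here `0 ≤ i < s`). -/
theorem llrk_stage_quadratic_estimate (d s : ℕ)
    (f : EuclideanSpace ℝ (Fin d) → EuclideanSpace ℝ (Fin d)) (hf : ContDiff ℝ 2 f)
    (hbd : ∀ i ≤ 2, ∃ B : ℝ, ∀ x, ‖iteratedFDeriv ℝ i f x‖ ≤ B)
    (c : ℕ → ℝ) (a : ℕ → ℕ → ℝ)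
    (ξ : EuclideanSpace ℝ (Fin d)) (hξ : f ξ = 0) (h : ℝ) (hh : 0 < h) :
    ∃ C > 0, ∀ y : EuclideanSpace ℝ (Fin d), ∀ i < s,
      ‖kstage f c a y h i‖ ≤ C * ‖y - ξ‖ ^ 2 := by
  obtain ⟨L, hL⟩ := hbd 1 (by norm_num)
  obtain ⟨M, hM⟩ := hbd 2 le_rfl
  have hL' : ∀ x, ‖fderiv ℝ f x‖ ≤ L := fun x => by
    simpa only [norm_iteratedFDeriv_one] using hL x
  have hM' : ∀ x, ‖fderiv ℝ (fderiv ℝ f) x‖ ≤ M := fun x => by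
    rw [← norm_iteratedFDeriv_one, norm_iteratedFDeriv_fderiv]
    exact hM x
  choose C hC0 hC using exists_norm_kstage_le hf hL' hM' hξ c a h
  refine ⟨∑ i ∈ Finset.range s, C i + 1,
    add_pos_of_nonneg_of_pos (Finset.sum_nonneg fun i _ => hC0 i) one_pos, fun y i hi => ?_⟩
  refine (hC i y).trans ?_
  gcongr
  exact (Finset.single_le_sum (fun j _ => hC0 j) (Finset.mem_range.2 hi)).trans
    (le_add_of_nonneg_right zero_le_one)

end
end

section
/- Let z, y ∈ ℂ and let M be the 2×2 complex matrix with rows (z, z·y) and (0, 0). Let N, D be complex polynomials with N(0) = 1 and D(0) = 1, and suppose D(z) ≠ 0. Then the matrix D(M) (polynomial evaluation of D at M) is invertible, and for every m ∈ ℕ the matrix Q^m, where Q := N(M)·D(M)^{−1}, equals the 2×2 matrix with rows (w^m, (w^m − 1)·y) and (0, 1), where w := N(z)/D(z). Consequently y + (Q^m)_{1,2} = w^m · y; i.e., applied to the scalar test equation x′ = λx, the LLRK scheme based on the rational approximation N/D of the exponential reduces to the recurrence y_{n+1} = R(λ)·y_n with stability function R = (N/D)^m. -/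
open Polynomial

/-- Evaluating a polynomial at the upper triangular matrix with rows `(z, z * y)` and `(0, 0)`. -/
theorem Polynomial.aeval_matrix_row {R : Type*} [CommRing R] (z y : R) (P : Polynomial R) :
    Polynomial.aeval (!![z, z * y; 0, 0] : Matrix (Fin 2) (Fin 2) R) P =
      !![P.eval z, (P.eval z - P.eval 0) * y; 0, P.eval 0] := by
  induction P using Polynomial.induction_on with
  | C a =>
    ext i j
    fin_cases i <;> fin_cases j <;> simp [Matrix.algebraMap_eq_diagonal]
  | add p q hp hq =>
    rw [map_add, hp, hq]
    ext i j
    fin_cases i <;> fin_cases j <;> simp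
    ring
  | monomial n a h =>
    rw [pow_succ, ← mul_assoc, map_mul, h, Polynomial.aeval_X]
    ext i j
    fin_cases i <;> fin_cases j <;> simp
    ring

/-- Powers of the upper triangular matrix with rows `(w, (w - 1) * y)` and `(0, 1)`. -/
theorem Matrix.fin_two_affine_pow {R : Type*} [CommRing R] (w y : R) (m : ℕ) :
    (!![w, (w - 1) * y; 0, 1] : Matrix (Fin 2) (Fin 2) R) ^ m =
      !![w ^ m, (w ^ m - 1) * y; 0, 1] := by
  induction m with
  | zero => simp [Matrix.one_fin_two]
  | succ m ih =>
    rw [pow_succ, ih]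
    ext i j
    fin_cases i <;> fin_cases j <;> simp <;> ring

/-- For the 2×2 matrix `M = [[z, z·y],[0,0]]` and polynomials `N`, `D`
with `N(0) = D(0) = 1` and `D(z) ≠ 0`, the matrix `D(M)` is invertible and, with
`Q := N(M)·D(M)⁻¹` and `w := N(z)/D(z)`, one has `Q^m = [[w^m, (w^m−1)·y],[0,1]]` and
`y + (Q^m)₁₂ = w^m·y` for every `m`: the LLRK scheme applied to the scalar test equation
`x′ = λx` reduces to `y_{n+1} = R(λ)·y_n` with stability function `R = (N/D)^m`. -/
theorem llrk_scalar_test_equation_stability (z y : ℂ) (N D : Polynomial ℂ)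
    (hN : N.eval 0 = 1) (hD : D.eval 0 = 1) (hz : D.eval z ≠ 0) :
    let M : Matrix (Fin 2) (Fin 2) ℂ := !![z, z * y; 0, 0]
    let w : ℂ := N.eval z / D.eval z
    let Q : Matrix (Fin 2) (Fin 2) ℂ := Polynomial.aeval M N * (Polynomial.aeval M D)⁻¹
    IsUnit (Polynomial.aeval M D) ∧
      ∀ m : ℕ, Q ^ m = !![w ^ m, (w ^ m - 1) * y; 0, 1] ∧
        y + (Q ^ m) 0 1 = w ^ m * y := by
  intro M w Q
  have hDM : Polynomial.aeval M D = !![D.eval z, (D.eval z - 1) * y; 0, 1] := by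
    rw [Polynomial.aeval_matrix_row, hD]
  have hdet : IsUnit (Polynomial.aeval M D).det := by
    simpa [hDM, Matrix.det_fin_two] using hz
  have hQ : Q = !![w, (w - 1) * y; 0, 1] := by
    have hmul : !![w, (w - 1) * y; 0, 1] * Polynomial.aeval M D = Polynomial.aeval M N := by
      have hw : w * D.eval z = N.eval z := div_mul_cancel₀ _ hz
      rw [hDM, Polynomial.aeval_matrix_row, hN]
      ext i j
      fin_cases i <;> fin_cases j <;> simp [hw]
      linear_combination y * hw
    simp only [Q]
    rw [← hmul, Matrix.mul_nonsing_inv_cancel_right _ _ hdet]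
  refine ⟨(Matrix.isUnit_iff_isUnit_det _).2 hdet, fun m => ?_⟩
  have hpow : Q ^ m = !![w ^ m, (w ^ m - 1) * y; 0, 1] := by
    rw [hQ, Matrix.fin_two_affine_pow]
  refine ⟨hpow, ?_⟩
  rw [hpow]
  simp only [Matrix.of_apply, Matrix.cons_val_zero, Matrix.cons_val_one]
  ring
end
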